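/- arXiv:2506.22354 — 2 statements merged into one kernel-verified Lean document; each statement's English description precedes it below -/
import Mathlib

section
/- With the explicit functions x, y, yₙ defined in the context: (i) x(y(t)) = 0 for every t ≥ 0; (ii) for every integer n ≥ 1, every δ > 0 with nδ > 1 and every T ≥ 2, one has ω_𝕄(x ∘ yₙ, δ, T) = 1. In particular, x ∘ yₙ does not converge to the zero function in the sense that ω_𝕄(x∘yₙ, δ, T) does not tend to 0. -/
/-- `𝕄(x₁,x₂,x₃)`: the infimum distance from `x₂` to the segment `[x₁,x₃]` in `ℝ`. -/
noncomputable def MM (x₁ x₂ x₃ : ℝ) : ℝ :=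
  Metric.infDist x₂ (segment ℝ x₁ x₃)

/-- The oscillation modulus `ω_𝕄(f,δ,T)`. -/
noncomputable def omegaM (f : ℝ → ℝ) (δ T : ℝ) : ℝ :=
  sSup {r : ℝ | ∃ t₁ t₂ t₃ : ℝ, 0 ≤ t₁ ∧ t₁ < t₂ ∧ t₂ < t₃ ∧ t₃ ≤ T ∧
    t₃ - t₁ < δ ∧ r = MM (f t₁) (f t₂) (f t₃)}

/-- `yₙ(t) = t/(2 − 1/n)` on `[0, 2 − 1/n]`, `2 + n(t − 2)` on `[2 − 1/n, 2]`,
and `t` for `t ≥ 2`. -/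
noncomputable def yn (n : ℕ) (t : ℝ) : ℝ :=
  if t ≤ 2 - 1 / (n : ℝ) then t / (2 - 1 / (n : ℝ))
  else if t ≤ 2 then 2 + (n : ℝ) * (t - 2)
  else t

/-- `y(t) = t/2` on `[0,2)` and `y(t) = t` for `t ≥ 2`. -/
noncomputable def ylim (t : ℝ) : ℝ :=
  if t < 2 then t / 2 else t

/-- `x(t) = 1 − |2t − 3|` on `[1,2]`, `x(t) = 0` on `[0,1] ∪ [2,∞)`. -/
noncomputable def xfun (t : ℝ) : ℝ :=
  if 1 ≤ t ∧ t ≤ 2 then 1 - |2 * t - 3| else 0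

theorem MM_le_abs_sub (a b c : ℝ) : MM a b c ≤ |b - a| := by
  rw [← Real.dist_eq]
  exact Metric.infDist_le_dist_of_mem (left_mem_segment ℝ a c)

theorem MM_self_left_right (a b : ℝ) : MM a b a = |b - a| := by
  rw [MM, segment_same, Metric.infDist_singleton, Real.dist_eq]

theorem xfun_mem_Icc (t : ℝ) : xfun t ∈ Set.Icc (0 : ℝ) 1 := by
  unfold xfun
  split_ifs with h
  · have h₁ : |2 * t - 3| ≤ 1 := abs_le.2 ⟨by linarith [h.1], by linarith [h.2]⟩
    exact ⟨by linarith, by linarith [abs_nonneg (2 * t - 3)]⟩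
  · exact ⟨le_rfl, zero_le_one⟩

theorem xfun_one : xfun 1 = 0 := by norm_num [xfun]

theorem xfun_two : xfun 2 = 0 := by norm_num [xfun]

theorem xfun_three_halves : xfun (3 / 2) = 1 := by norm_num [xfun]

theorem xfun_ylim (t : ℝ) : xfun (ylim t) = 0 := by
  unfold ylim
  split_ifs with h
  · exact if_neg fun h₁ => by linarith [h₁.1]
  · rcases (not_lt.1 h).eq_or_lt with rfl | h₂
    · exact xfun_two
    · exact if_neg fun h₁ => h₁.2.not_gt h₂

theorem yn_left {n : ℕ} (hn : 1 ≤ n) : yn n (2 - 1 / n) = 1 := by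
  have h : 1 / (n : ℝ) ≤ 1 := (div_le_one (by positivity)).2 (by exact_mod_cast hn)
  rw [yn, if_pos le_rfl, div_self (by linarith)]

theorem yn_midpoint {n : ℕ} (hn : 1 ≤ n) : yn n (2 - 1 / n / 2) = 3 / 2 := by
  have h₀ : (0 : ℝ) < n := by exact_mod_cast hn
  have h : 0 < 1 / (n : ℝ) := by positivity
  rw [yn, if_neg (by linarith), if_pos (by linarith)]
  field_simp
  ring

theorem yn_two {n : ℕ} (hn : 1 ≤ n) : yn n 2 = 2 := by
  have h₀ : (0 : ℝ) < n := by exact_mod_cast hn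
  have h : 0 < 1 / (n : ℝ) := by positivity
  rw [yn, if_neg (by linarith), if_pos le_rfl]
  ring

theorem omegaM_xfun_comp_yn {n : ℕ} (hn : 1 ≤ n) {δ T : ℝ} (hδ : (n : ℝ) * δ > 1)
    (hT : 2 ≤ T) : omegaM (xfun ∘ yn n) δ T = 1 := by
  have h₀ : (0 : ℝ) < n := by exact_mod_cast hn
  have hpos : 0 < 1 / (n : ℝ) := by positivity
  have hle : 1 / (n : ℝ) ≤ 1 := (div_le_one h₀).2 (by exact_mod_cast hn)
  have hlt : 1 / (n : ℝ) < δ := (div_lt_iff₀' h₀).2 hδ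
  refine IsGreatest.csSup_eq ⟨⟨2 - 1 / n, 2 - 1 / n / 2, 2, by linarith, by linarith,
    by linarith, hT, by linarith, ?_⟩, ?_⟩
  · simp only [Function.comp_apply, yn_left hn, yn_midpoint hn, yn_two hn, xfun_one,
      xfun_two, xfun_three_halves, MM_self_left_right]
    norm_num
  · rintro r ⟨t₁, t₂, t₃, -, -, -, -, -, rfl⟩
    refine (MM_le_abs_sub _ _ _).trans ?_
    have h₁ := xfun_mem_Icc (yn n t₁)
    have h₂ := xfun_mem_Icc (yn n t₂)
    exact abs_le.2 ⟨by simp only [Function.comp_apply]; linarith [h₁.2, h₂.1],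
      by simp only [Function.comp_apply]; linarith [h₁.1, h₂.2]⟩

theorem stmt_3 :
    (∀ t : ℝ, 0 ≤ t → xfun (ylim t) = 0) ∧
      (∀ n : ℕ, 1 ≤ n → ∀ δ : ℝ, 0 < δ → (n : ℝ) * δ > 1 → ∀ T : ℝ, 2 ≤ T →
        omegaM (xfun ∘ yn n) δ T = 1) ∧
      (∀ δ : ℝ, 0 < δ → ∀ T : ℝ, 2 ≤ T →
        ¬ Filter.Tendsto (fun n : ℕ => omegaM (xfun ∘ yn n) δ T)
            Filter.atTop (nhds 0)) := by
  refine ⟨fun t _ => xfun_ylim t, fun n hn δ _ h T hT => omegaM_xfun_comp_yn hn h hT,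
    fun δ hδ T hT hlim => ?_⟩
  have hev : ∀ᶠ n : ℕ in Filter.atTop, omegaM (xfun ∘ yn n) δ T = 1 := by
    obtain ⟨N, hN⟩ := exists_nat_gt (1 / δ)
    filter_upwards [Filter.eventually_ge_atTop (max N 1)] with n hn
    have hNn : (N : ℝ) ≤ n := by exact_mod_cast (le_max_left N 1).trans hn
    exact omegaM_xfun_comp_yn ((le_max_right N 1).trans hn)
      ((div_lt_iff₀ hδ).1 (hN.trans_le hNn)) hT
  exact zero_ne_one (tendsto_nhds_unique hlim (tendsto_const_nhds.congr' (hev.mono fun _ h => h.symm)))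
end

section
/- (Characteristic function of the Linnik law.) Let t > 0, let X be a random variable with the Gamma distribution of shape t and rate 1 (density a ↦ a^{t−1} e^{−a}/Γ(t) on (0,∞)), and let Z be a standard Gaussian random variable independent of X. Then for every λ ∈ ℝ, E[ exp(i λ √X · Z) ] = (1 + λ²/2)^{−t}. -/
open MeasureTheory ProbabilityTheory

/-- The moment generating function of the Gamma distribution with shape `a` and rate `r`. -/
theorem mgf_id_gammaMeasure {a r s : ℝ} (ha : 0 < a) (hr : 0 < r) (hs : s < r) :
    mgf id (gammaMeasure a r) s = (1 - s / r) ^ (-a) := by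
  have hrs : 0 < r - s := sub_pos.2 hs
  have hdensity (x : ℝ) : (gammaPDF a r x).toReal • Real.exp (s * x) =
      (Set.Ici (0 : ℝ)).indicator (fun x ↦ r ^ a / Real.Gamma a *
        (x ^ (a - 1) * Real.exp (-((r - s) * x)))) x := by
    rw [gammaPDF, ENNReal.toReal_ofReal (gammaPDFReal_nonneg ha hr x), gammaPDFReal]
    by_cases hx : 0 ≤ x
    · have hexp : Real.exp (-((r - s) * x)) = Real.exp (-(r * x)) * Real.exp (s * x) := by
        rw [← Real.exp_add]
        ring_nf
      simp only [hx, if_true, smul_eq_mul, Set.mem_Ici, Set.indicator_of_mem, hexp]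
      ring
    · simp [hx]
  have hmeas : Measurable (gammaPDF a r) := (measurable_gammaPDFReal a r).ennreal_ofReal
  simp only [mgf, id_eq]
  rw [gammaMeasure, integral_withDensity_eq_integral_toReal_smul hmeas (by simp [gammaPDF])]
  simp_rw [hdensity]
  rw [integral_indicator measurableSet_Ici, integral_Ici_eq_integral_Ioi, integral_const_mul,
    Real.integral_rpow_mul_exp_neg_mul_Ioi ha hrs, one_sub_div hr.ne',
    Real.rpow_neg (by positivity), Real.div_rpow hrs.le hr.le, Real.div_rpow zero_le_one hrs.le,
    Real.one_rpow]
  have := (Real.Gamma_pos_of_pos ha).ne'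
  field_simp

theorem stmt_12 {Ω : Type*} {m : MeasurableSpace Ω} (P : Measure Ω)
    [IsProbabilityMeasure P] (t : ℝ) (ht : 0 < t)
    (X Z : Ω → ℝ) (hX : Measurable X) (hZ : Measurable Z)
    (hindep : IndepFun X Z P)
    (hXlaw : P.map X = gammaMeasure t 1)
    (hZlaw : P.map Z = gaussianReal 0 1) :
    ∀ lam : ℝ,
      ∫ ω, Complex.exp (Complex.I * (lam : ℂ) * ((Real.sqrt (X ω) * Z ω : ℝ) : ℂ)) ∂P =
        ((1 : ℂ) + (lam : ℂ) ^ 2 / 2) ^ (-(t : ℂ)) := by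
  intro lam
  have : IsProbabilityMeasure (gammaMeasure t 1) :=
    isProbabilityMeasure_gammaMeasure ht one_pos
  let F : ℝ × ℝ → ℂ := fun p ↦
    Complex.exp (Complex.I * (lam : ℂ) * ((Real.sqrt p.1 * p.2 : ℝ) : ℂ))
  have hF : Continuous F := by fun_prop
  have hFint : Integrable F ((gammaMeasure t 1).prod (gaussianReal 0 1)) := by
    refine Integrable.of_bound hF.aestronglyMeasurable 1 (ae_of_all _ fun p ↦ ?_)
    simp [F, Complex.norm_exp]
  have hgauss (x : ℝ) : ∫ z, F (x, z) ∂gaussianReal 0 1 =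
      Complex.exp (-((lam * √x) ^ 2 / 2 : ℝ)) := by
    have h := charFun_gaussianReal (μ := 0) (v := 1) (lam * √x)
    rw [charFun_apply_real] at h
    convert h using 1
    · refine integral_congr_ae (ae_of_all _ fun z ↦ ?_)
      simp only [F]
      push_cast
      ring_nf
    · push_cast
      ring_nf
  have hnonneg : ∀ᵐ x ∂gammaMeasure t 1, 0 ≤ x := by
    rw [ae_iff, gammaMeasure, withDensity_apply _ (by measurability)]
    simpa [Set.Iio_def] using lintegral_gammaPDF_of_nonpos (a := t) (r := 1) le_rfl
  calc
    _ = ∫ p, F p ∂(P.map fun ω ↦ (X ω, Z ω)) :=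
      (integral_map (by fun_prop) hF.aestronglyMeasurable).symm
    _ = ∫ x, ∫ z, F (x, z) ∂gaussianReal 0 1 ∂gammaMeasure t 1 := by
      rw [hindep.map_prod_eq_prod_map_map hX.aemeasurable hZ.aemeasurable, hXlaw, hZlaw,
        integral_prod _ hFint]
    _ = ∫ x, ((Real.exp (-(lam ^ 2 / 2) * x) : ℝ) : ℂ) ∂gammaMeasure t 1 := by
      refine integral_congr_ae (hnonneg.mono fun x hx ↦ ?_)
      simp only [hgauss]
      rw [mul_pow, Real.sq_sqrt hx]
      push_cast
      ring_nf
    _ = (((1 + lam ^ 2 / 2) ^ (-t) : ℝ) : ℂ) := by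
      rw [integral_complex_ofReal]
      have h := mgf_id_gammaMeasure ht one_pos (s := -(lam ^ 2 / 2))
        (by linarith [sq_nonneg lam])
      simp only [mgf, id_eq, div_one, sub_neg_eq_add] at h
      rw [h]
    _ = _ := by
      rw [Complex.ofReal_cpow (by positivity)]
      push_cast
      rfl
end
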